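/- Let g, h ≥ 2 be integers. For Lebesgue-almost every x ∈ [0,1), the set of jump times J(x) = {n ≥ 1 : m_g^{(h)}(x,n) > m_g^{(h)}(x,n−1)} is infinite, and if (n_k)_{k≥1} is its increasing enumeration then lim_{k→∞} m_g^{(h)}(x,n_k)/n_k = log g / log h. -/

import Mathlib

open MeasureTheory Filter Set

/-- The `g`-adic cylinder of rank `n` containing `x`. -/
noncomputable def radixCyl (g : ℕ) (n : ℕ) (x : ℝ) : Set ℝ :=
  Set.Ico ((⌊(g : ℝ) ^ n * x⌋ : ℝ) / (g : ℝ) ^ n) (((⌊(g : ℝ) ^ n * x⌋ : ℝ) + 1) / (g : ℝ) ^ n)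

/-- `mRadix g h x n` is the largest `m` with `A_n^{(g)}(x) ⊆ A_m^{(h)}(x)`. -/
noncomputable def mRadix (g h : ℕ) (x : ℝ) (n : ℕ) : ℕ :=
  sSup {m : ℕ | radixCyl g n x ⊆ radixCyl h m x}

/-- The jump times of `n ↦ mRadix g h x n`. -/
def jumpTimes (g h : ℕ) (x : ℝ) : ℕ → Prop :=
  fun n => 1 ≤ n ∧ mRadix g h x (n - 1) < mRadix g h x n


lemma radix_le_of_mem {g h : ℕ} (hg : 2 ≤ g) (hh : 2 ≤ h) {x : ℝ} {n m : ℕ}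
    (H : radixCyl g n x ⊆ radixCyl h m x) : h ^ m ≤ g ^ n := by
  have hgp : (0 : ℝ) < (g : ℝ) ^ n := by positivity
  have hhp : (0 : ℝ) < (h : ℝ) ^ m := by positivity
  unfold radixCyl at H
  rw [Set.Ico_subset_Ico_iff (by gcongr; linarith)] at H
  obtain ⟨h1, h2⟩ := H
  rw [add_div, add_div] at h2
  have h3 : 1 / (g : ℝ) ^ n ≤ 1 / (h : ℝ) ^ m := by linarith
  have h4 := (one_div_le_one_div hgp hhp).1 h3
  exact_mod_cast h4

lemma radix_bdd {g h : ℕ} (hg : 2 ≤ g) (hh : 2 ≤ h) (x : ℝ) (n : ℕ) :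
    BddAbove {m : ℕ | radixCyl g n x ⊆ radixCyl h m x} := by
  refine ⟨g ^ n, fun m hm => ?_⟩
  exact (Nat.lt_pow_self (by omega)).le.trans (radix_le_of_mem hg hh hm)

lemma radix_zero_mem {g h : ℕ} (hg : 2 ≤ g) {x : ℝ} (hx : x ∈ Set.Ico (0 : ℝ) 1) (n : ℕ) :
    radixCyl g n x ⊆ radixCyl h 0 x := by
  have hgp : (0 : ℝ) < (g : ℝ) ^ n := by positivity
  have h0 : ⌊x⌋ = 0 := Int.floor_eq_zero_iff.2 hx
  unfold radixCyl
  simp only [pow_zero, one_mul, h0, div_one, Int.cast_zero, zero_add]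
  apply Set.Ico_subset_Ico
  · have : (0 : ℤ) ≤ ⌊(g : ℝ) ^ n * x⌋ := Int.floor_nonneg.2 (mul_nonneg hgp.le hx.1)
    have : (0 : ℝ) ≤ ⌊(g : ℝ) ^ n * x⌋ := by exact_mod_cast this
    positivity
  · rw [div_le_one hgp]
    have : ⌊(g : ℝ) ^ n * x⌋ < (g : ℤ) ^ n := by
      rw [Int.floor_lt]
      push_cast
      nlinarith [hx.2]
    have : ⌊(g : ℝ) ^ n * x⌋ + 1 ≤ (g : ℤ) ^ n := by omega
    exact_mod_cast this

lemma mRadix_upper {g h : ℕ} (hg : 2 ≤ g) (hh : 2 ≤ h) {x : ℝ} (hx : x ∈ Set.Ico (0 : ℝ) 1)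
    (n : ℕ) : h ^ (mRadix g h x n) ≤ g ^ n :=
  radix_le_of_mem hg hh (Nat.sSup_mem ⟨0, radix_zero_mem hg hx n⟩ (radix_bdd hg hh x n))

/-- The bad set. -/
def badSet (h m : ℕ) : Set ℝ :=
  ⋃ k ∈ Finset.range (h ^ m + 1),
    Set.Ioo (((k : ℝ) - 1 / ((m : ℝ) + 1) ^ 2) / (h : ℝ) ^ m)
      (((k : ℝ) + 1 / ((m : ℝ) + 1) ^ 2) / (h : ℝ) ^ m)

lemma vol_badSet {h : ℕ} (hh : 2 ≤ h) (m : ℕ) :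
    volume (badSet h m) ≤ ENNReal.ofReal (4 * (1 / ((m : ℝ) + 1) ^ 2)) := by
  have hhp : (1 : ℝ) ≤ (h : ℝ) ^ m := one_le_pow₀ (by exact_mod_cast (by omega : 1 ≤ h))
  have hd : (0 : ℝ) < 1 / ((m : ℝ) + 1) ^ 2 := by positivity
  set d := 1 / ((m : ℝ) + 1) ^ 2 with hdd
  refine (measure_biUnion_finset_le _ _).trans ?_
  simp only [Real.volume_Ioo]
  rw [← ENNReal.ofReal_sum_of_nonneg]
  · apply ENNReal.ofReal_le_ofReal
    have : ∀ k ∈ Finset.range (h ^ m + 1),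
        ((k : ℝ) + d) / (h : ℝ) ^ m - ((k : ℝ) - d) / (h : ℝ) ^ m = 2 * d / (h : ℝ) ^ m := by
      intro k _
      ring
    rw [Finset.sum_congr rfl this, Finset.sum_const, Finset.card_range, nsmul_eq_mul]
    push_cast
    rw [mul_div_assoc', div_le_iff₀ (by positivity)]
    nlinarith
  · intro k _
    rw [sub_nonneg]
    gcongr
    linarith

lemma ae_good {h : ℕ} (hh : 2 ≤ h) :
    ∀ᵐ x ∂(volume : Measure ℝ), ∀ᶠ m in atTop, x ∉ badSet h m := by
  apply ae_eventually_notMem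
  have hs : Summable (fun m : ℕ => 4 * (1 / ((m : ℝ) + 1) ^ 2)) := by
    apply Summable.mul_left
    have := (summable_nat_add_iff 1).2 (Real.summable_one_div_nat_pow.2 (by norm_num : 1 < 2))
    simpa using this
  refine ne_top_of_le_ne_top ?_ (ENNReal.tsum_le_tsum (fun m => vol_badSet hh m))
  exact hs.tsum_ofReal_ne_top

lemma mem_of_good {g h : ℕ} (hg : 2 ≤ g) (hh : 2 ≤ h) {x : ℝ} (hx : x ∈ Set.Ico (0 : ℝ) 1)
    {n m : ℕ} (hgood : x ∉ badSet h m) (hle : ((m : ℝ) + 1) ^ 2 * (h : ℝ) ^ m ≤ (g : ℝ) ^ n) :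
    radixCyl g n x ⊆ radixCyl h m x := by
  have hgp : (0 : ℝ) < (g : ℝ) ^ n := by positivity
  have hhp : (0 : ℝ) < (h : ℝ) ^ m := by positivity
  have hd : (0 : ℝ) < 1 / ((m : ℝ) + 1) ^ 2 := by positivity
  have hL : 1 / (g : ℝ) ^ n ≤ (1 / ((m : ℝ) + 1) ^ 2) / (h : ℝ) ^ m := by
    rw [div_div]
    exact one_div_le_one_div_of_le (by positivity) hle
  obtain ⟨k, hk⟩ : ∃ k : ℕ, ⌊(h : ℝ) ^ m * x⌋ = k :=
    Int.eq_ofNat_of_zero_le (Int.floor_nonneg.2 (mul_nonneg hhp.le hx.1))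
  obtain ⟨h1, h2⟩ := Int.floor_eq_iff.1 hk
  rw [Int.cast_natCast] at h1 h2
  have hkl : k < h ^ m := by
    have : (k : ℝ) < (h : ℝ) ^ m := by nlinarith [hx.2]
    exact_mod_cast this
  unfold badSet at hgood
  simp only [Set.mem_iUnion, not_exists] at hgood
  have a1 := hgood k (Finset.mem_range.2 (by omega))
  have a2 := hgood (k + 1) (Finset.mem_range.2 (by omega))
  unfold radixCyl
  rw [hk]
  have f1 := Int.floor_le ((g : ℝ) ^ n * x)
  have f2 := Int.lt_floor_add_one ((g : ℝ) ^ n * x)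
  set q : ℝ := (⌊(g : ℝ) ^ n * x⌋ : ℝ)
  set d := 1 / ((m : ℝ) + 1) ^ 2
  have b1 : ((k : ℝ) + d) / (h : ℝ) ^ m ≤ x := by
    by_contra hc
    push Not at hc
    refine a1 ⟨?_, hc⟩
    rw [div_lt_iff₀ hhp]; linarith
  have b2 : x ≤ ((k : ℝ) + 1 - d) / (h : ℝ) ^ m := by
    by_contra hc
    push Not at hc
    refine a2 ⟨by push_cast; exact hc, ?_⟩
    rw [lt_div_iff₀ hhp]; push_cast; linarith
  have e1 : x < (q + 1) / (g : ℝ) ^ n := by rw [lt_div_iff₀ hgp]; linarith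
  have e2 : q / (g : ℝ) ^ n ≤ x := by rw [div_le_iff₀ hgp]; linarith
  apply Set.Ico_subset_Ico
  · rw [add_div] at e1 b1
    push_cast
    linarith
  · rw [sub_div] at b2
    rw [add_div q]
    push_cast
    linarith

lemma tendsto_mRadix {g h : ℕ} (hg : 2 ≤ g) (hh : 2 ≤ h) {x : ℝ} (hx : x ∈ Set.Ico (0 : ℝ) 1)
    (hgood : ∀ᶠ m in atTop, x ∉ badSet h m) :
    Tendsto (fun n : ℕ => (mRadix g h x n : ℝ) / n) atTop (nhds (Real.log g / Real.log h)) := by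
  have hlg : 0 < Real.log g := Real.log_pos (by exact_mod_cast (by omega : 1 < g))
  have hlh : 0 < Real.log h := Real.log_pos (by exact_mod_cast (by omega : 1 < h))
  set c := Real.log g / Real.log h with hc
  have hcp : 0 < c := by positivity
  have hup : ∀ n, (mRadix g h x n : ℝ) ≤ c * n := by
    intro n
    have h1 : ((h : ℝ) ^ (mRadix g h x n)) ≤ (g : ℝ) ^ n := by
      exact_mod_cast mRadix_upper hg hh hx n
    have h2 := Real.log_le_log (by positivity) h1
    rw [Real.log_pow, Real.log_pow] at h2
    rw [hc, div_mul_eq_mul_div, le_div_iff₀ hlh]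
    linarith
  obtain ⟨m0, hm0⟩ := eventually_atTop.1 hgood
  have hpow : Tendsto (fun n : ℕ => (g : ℝ) ^ n) atTop atTop :=
    tendsto_pow_atTop_atTop_of_one_lt (by exact_mod_cast (by omega : 1 < g))
  have hlow : ∀ᶠ n : ℕ in atTop,
      c * n - 1 - 2 * Real.log (c * n + 2) / Real.log h ≤ (mRadix g h x n : ℝ) := by
    filter_upwards [hpow.eventually_ge_atTop (((m0 : ℝ) + 1) ^ 2 * (h : ℝ) ^ m0)] with n hn
    have hM0 : m0 ≤ mRadix g h x n :=
      le_csSup (radix_bdd hg hh x n) (mem_of_good hg hh hx (hm0 m0 le_rfl) hn)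
    have hnot : ¬ (radixCyl g n x ⊆ radixCyl h (mRadix g h x n + 1) x) := by
      intro hc
      have := le_csSup (radix_bdd hg hh x n) hc
      unfold mRadix at this
      omega
    have hlt : (g : ℝ) ^ n < (((mRadix g h x n + 1 : ℕ) : ℝ) + 1) ^ 2
        * (h : ℝ) ^ (mRadix g h x n + 1) := by
      by_contra hcon
      push Not at hcon
      exact hnot (mem_of_good hg hh hx (hm0 _ (by omega)) hcon)
    have hM := hup n
    set M := mRadix g h x n
    have h2 := Real.log_le_log (by positivity) hlt.le
    rw [Real.log_mul (by positivity) (by positivity), Real.log_pow, Real.log_pow,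
      Real.log_pow] at h2
    push_cast at h2
    have h3 : Real.log ((M : ℝ) + 1 + 1) ≤ Real.log (c * n + 2) :=
      Real.log_le_log (by positivity) (by linarith)
    have h4 : c * n * Real.log h = n * Real.log g := by rw [hc]; field_simp
    rw [sub_le_iff_le_add, ← sub_le_iff_le_add', le_div_iff₀ hlh]
    nlinarith
  have hlog : Tendsto (fun n : ℕ => Real.log (c * n + 2) / (c * n + 2)) atTop (nhds 0) := by
    have h1 : Tendsto (fun y : ℝ => Real.log y / y) atTop (nhds 0) :=
      Real.isLittleO_log_id_atTop.tendsto_div_nhds_zero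
    have h2 : Tendsto (fun n : ℕ => c * (n : ℝ) + 2) atTop atTop :=
      tendsto_atTop_add_const_right _ _
        (tendsto_natCast_atTop_atTop.const_mul_atTop hcp)
    exact h1.comp h2
  have hinv : Tendsto (fun n : ℕ => 1 / (n : ℝ)) atTop (nhds 0) := tendsto_one_div_atTop_nhds_zero_nat
  have hL : Tendsto (fun n : ℕ => c - 1 / (n : ℝ) - 2 / Real.log h *
      (Real.log (c * n + 2) / (c * n + 2) * (c + 2 * (1 / (n : ℝ))))) atTop (nhds c) := by
    have := (tendsto_const_nhds (x := c)).sub hinv |>.sub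
      ((hlog.mul ((tendsto_const_nhds (x := c)).add (hinv.const_mul 2))).const_mul
        (2 / Real.log h))
    simpa using this
  refine tendsto_of_tendsto_of_tendsto_of_le_of_le' hL tendsto_const_nhds ?_ ?_
  · filter_upwards [hlow, eventually_gt_atTop 0] with n hn hn0
    have hn' : (0 : ℝ) < n := by exact_mod_cast hn0
    have : (0 : ℝ) < c * n + 2 := by positivity
    rw [le_div_iff₀ hn']
    refine le_trans (le_of_eq ?_) hn
    have e : c + 2 * (1 / (n : ℝ)) = (c * n + 2) / n := by field_simp
    rw [e]
    field_simp
  · filter_upwards [eventually_gt_atTop 0] with n hn0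
    have hn' : (0 : ℝ) < n := by exact_mod_cast hn0
    rw [div_le_iff₀ hn']
    exact hup n

theorem limit_along_jump_times (g h : ℕ) (hg : 2 ≤ g) (hh : 2 ≤ h) :
    ∀ᵐ x ∂(volume : Measure ℝ), x ∈ Set.Ico (0 : ℝ) 1 →
      {n : ℕ | jumpTimes g h x n}.Infinite ∧
        Tendsto (fun k : ℕ =>
            (mRadix g h x (Nat.nth (jumpTimes g h x) k) : ℝ) / (Nat.nth (jumpTimes g h x) k))
          atTop (nhds (Real.log g / Real.log h)) := by
  filter_upwards [ae_good hh] with x hgood hx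
  have hT := tendsto_mRadix hg hh hx hgood
  have hinf : {n : ℕ | jumpTimes g h x n}.Infinite := by
    intro hfin
    obtain ⟨N, hN⟩ := hfin.bddAbove
    have hb : ∀ j, mRadix g h x (N + j) ≤ mRadix g h x N := by
      intro j
      induction j with
      | zero => simp
      | succ j ih =>
        by_contra hcon
        have : jumpTimes g h x (N + (j + 1)) := ⟨by omega, by
          rw [show N + (j + 1) - 1 = N + j by omega]; omega⟩
        have := hN this
        omega
    have hlg : 0 < Real.log g := Real.log_pos (by exact_mod_cast (by omega : 1 < g))
    have hlh : 0 < Real.log h := Real.log_pos (by exact_mod_cast (by omega : 1 < h))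
    have h0 : Tendsto (fun n : ℕ => (mRadix g h x n : ℝ) / n) atTop (nhds 0) := by
      refine tendsto_of_tendsto_of_tendsto_of_le_of_le' tendsto_const_nhds
        (tendsto_const_div_atTop_nhds_zero_nat (mRadix g h x N : ℝ)) ?_ ?_
      · exact Eventually.of_forall fun n => by positivity
      · filter_upwards [eventually_ge_atTop N] with n hn
        have := hb (n - N)
        rw [show N + (n - N) = n by omega] at this
        gcongr
    have := tendsto_nhds_unique hT h0
    exact absurd this (by positivity)
  exact ⟨hinf, hT.comp (Nat.nth_strictMono hinf).tendsto_atTop⟩
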